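/- arXiv:math/0011165 — 2 statements merged into one kernel-verified Lean document; each statement's English description precedes it below -/
import Mathlib

section
/- Let W be a complex vector space, let m ≥ 1, and let s : {1,…,m} → ℝ and u, w : {1,…,m} → W be arbitrary assignments. Then in the exterior power Λ^{m−1}_ℂ W one has the identity −Alt_m [ Σ_{k≥0, 2k+1≤m} (C(m,2k+1)/m!) · s_1 · u_2∧…∧u_{2k+1} ∧ w_{2k+2}∧…∧w_m ] = Alt_m [ Σ_{k=1}^{m} ((−1)^{m−k−1}/m!) · s_1 · (u_2+w_2)∧…∧(u_k+w_k) ∧ (u_{k+1}−w_{k+1})∧…∧(u_m−w_m) ], where Alt_m acts by simultaneously permuting the triples (s_j, u_j, w_j) over all indices j. (This is the pointwise/formal content of Proposition 2.1: the two expressions for the form r_m(f_1,…,f_m), obtained by substituting s_j = log|f_j|, u_j = d log|f_j|, w_j = d i arg f_j, so that u_j + w_j = d log f_j and u_j − w_j = d(conjugate of log f_j).) -/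
open ExteriorAlgebra

/-- A multilinear map at `aⱼ xⱼ + bⱼ yⱼ`, expanded over the subsets on which `x` is chosen. -/
theorem MultilinearMap.map_smul_add_smul_univ {R ι M N : Type*} [CommRing R] [Fintype ι]
    [DecidableEq ι] [AddCommGroup M] [Module R M] [AddCommGroup N] [Module R N]
    (f : MultilinearMap R (fun _ : ι => M) N) (a b : ι → R) (x y : ι → M) :
    f (fun j => a j • x j + b j • y j) =
      ∑ S : Finset ι, ((∏ j ∈ S, a j) * ∏ j ∈ Sᶜ, b j) • f (S.piecewise x y) := by
  have h := f.map_add_univ (fun j => a j • x j) (fun j => b j • y j)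
  simp only [Pi.add_def] at h
  rw [h]
  refine Finset.sum_congr rfl fun S _ => ?_
  have : S.piecewise (fun j => a j • x j) (fun j => b j • y j) =
      fun j => (S.piecewise a b) j • (S.piecewise x y) j := by
    ext j
    by_cases hj : j ∈ S <;> simp [hj]
  rw [this, f.map_smul_univ, Finset.prod_piecewise]
  simp [Finset.compl_eq_univ_sdiff]

theorem Finset.exists_perm_mem_iff_of_card_eq {α : Type*} [Fintype α] [DecidableEq α]
    {S T : Finset α} (h : S.card = T.card) :
    ∃ π : Equiv.Perm α, ∀ j, π j ∈ T ↔ j ∈ S := by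
  let e := Finset.equivOfCardEq h
  refine ⟨Equiv.extendSubtype e, fun j => ⟨fun hj => ?_, fun hj => ?_⟩⟩
  · by_contra hS
    exact Equiv.extendSubtype_not_mem e j hS hj
  · exact Equiv.extendSubtype_mem e j hj

section AltProd

variable {R W : Type*} [CommRing R] [AddCommGroup W] [Module R W] {n : ℕ}

/-- The alternation of `s₀ · x₁ ∧ ⋯ ∧ xₙ`, where `xⱼ` is `uⱼ` for `j ∈ S` and `wⱼ` otherwise. -/
noncomputable def altWord (s : Fin (n + 1) → R) (u w : Fin (n + 1) → W) (S : Finset (Fin n)) :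
    ExteriorAlgebra R W :=
  ∑ σ : Equiv.Perm (Fin (n + 1)), (Equiv.Perm.sign σ : ℤ) • s (σ 0) •
    ιMulti R n (S.piecewise (fun j => u (σ j.succ)) (fun j => w (σ j.succ)))

theorem altWord_eq_of_card_eq (s : Fin (n + 1) → R) (u w : Fin (n + 1) → W)
    {S T : Finset (Fin n)} (h : S.card = T.card) : altWord s u w S = altWord s u w T := by
  obtain ⟨π, hπ⟩ := Finset.exists_perm_mem_iff_of_card_eq h
  let τ : Equiv.Perm (Fin (n + 1)) := Equiv.Perm.decomposeFin.symm (0, π)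
  have hτ0 : τ 0 = 0 := by simp [τ]
  have hτs : ∀ j : Fin n, τ j.succ = (π j).succ := by simp [τ]
  have hτ : Equiv.Perm.sign τ = Equiv.Perm.sign π := by simp [τ]
  unfold altWord
  refine Fintype.sum_equiv (Equiv.mulRight τ⁻¹) _ _ fun σ => ?_
  have key := (ιMulti R n).map_perm (T.piecewise (fun j => u ((σ * τ⁻¹) j.succ))
    (fun j => w ((σ * τ⁻¹) j.succ))) π
  have hcomp : (T.piecewise (fun j => u ((σ * τ⁻¹) j.succ))
      (fun j => w ((σ * τ⁻¹) j.succ))) ∘ π =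
      S.piecewise (fun j => u (σ j.succ)) (fun j => w (σ j.succ)) := by
    ext j
    have : (σ * τ⁻¹) (π j).succ = σ j.succ := by rw [← hτs]; simp
    by_cases hj : j ∈ S
    · have := (hπ j).2 hj
      simp_all
    · have := mt (hπ j).1 hj
      simp_all
  have h0 : (σ * τ⁻¹) 0 = σ 0 := by
    conv_lhs => rw [← hτ0]
    simp
  simp only [Equiv.coe_mulRight]
  rw [← hcomp, key, h0, Equiv.Perm.sign_mul, Equiv.Perm.sign_inv, hτ]
  simp only [Units.smul_def, Units.val_mul, mul_smul, smul_comm (s (σ 0))]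

open Polynomial in
/-- Alternated products of the vectors `aⱼ uⱼ + bⱼ wⱼ` depend linearly on the commutative
product of the polynomials `aⱼ X + bⱼ`. -/
theorem exists_linearMap_alt_eq (s : Fin (n + 1) → R) (u w : Fin (n + 1) → W) :
    ∃ L : R[X] →ₗ[R] ExteriorAlgebra R W, ∀ a b : Fin n → R,
      ∑ σ : Equiv.Perm (Fin (n + 1)), (Equiv.Perm.sign σ : ℤ) • s (σ 0) •
        ιMulti R n (fun j => a j • u (σ j.succ) + b j • w (σ j.succ)) =
      L (∏ j, (C (a j) * X + C (b j))) := by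
  refine ⟨(Polynomial.basisMonomials R).constr R
    fun r => altWord s u w {j | j.val < r}, fun a b => ?_⟩
  have hL (S : Finset (Fin n)) : ((Polynomial.basisMonomials R).constr R
      fun r => altWord s u w {j : Fin n | j.val < r}) (X ^ S.card) = altWord s u w S := by
    have hc : S.card ≤ n := by simpa using S.card_le_univ
    have hX : (X ^ S.card : R[X]) = Polynomial.basisMonomials R S.card := by
      rw [coe_basisMonomials, X_pow_eq_monomial]
    rw [hX, Module.Basis.constr_basis]
    exact altWord_eq_of_card_eq s u w (by simp [Fin.card_filter_val_lt, hc])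
  have hprod : ∏ j, (C (a j) * X + C (b j)) =
      ∑ S : Finset (Fin n), ((∏ j ∈ S, a j) * ∏ j ∈ Sᶜ, b j) • (X ^ S.card : R[X]) := by
    rw [Fintype.prod_add]
    refine Finset.sum_congr rfl fun S _ => ?_
    rw [Finset.prod_mul_distrib, Finset.prod_const, smul_eq_C_mul, map_mul, map_prod, map_prod]
    ring
  have hexp (σ : Equiv.Perm (Fin (n + 1))) := (ιMulti R n).toMultilinearMap.map_smul_add_smul_univ
    a b (fun j => u (σ j.succ)) (fun j => w (σ j.succ))
  simp only [AlternatingMap.coe_multilinearMap] at hexp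
  simp only [hprod, hexp, map_sum, map_smul, hL, Finset.smul_sum]
  simp only [altWord, Finset.smul_sum]
  rw [Finset.sum_comm]
  refine Finset.sum_congr rfl fun S _ => Finset.sum_congr rfl fun σ _ => ?_
  simp only [smul_comm ((∏ j ∈ S, a j) * ∏ j ∈ Sᶜ, b j)]

end AltProd

theorem List.prod_take_mul_prod_drop_finRange {A : Type*} [Monoid A] {n k : ℕ}
    (f g : Fin (n + 1) → A) :
    ((((List.finRange (n + 1)).drop 1).take k).map f).prod *
      (((List.finRange (n + 1)).drop (k + 1)).map g).prod =
    (List.ofFn fun j : Fin n => if j.val < k then f j.succ else g j.succ).prod := by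
  rw [← List.prod_append]
  congr 1
  apply List.ext_getElem
  · simp
    omega
  · intro i h₁ h₂
    simp only [List.length_ofFn] at h₂
    by_cases hi : i < k
    · rw [List.getElem_append_left (by simp; omega)]
      simp [hi]
    · rw [List.getElem_append_right (by simp; omega)]
      simp only [List.getElem_map, List.getElem_drop, List.getElem_finRange, List.getElem_ofFn, hi,
        if_false]
      congr 1
      simp [Fin.ext_iff]
      omega

theorem Fin.prod_ite_val_lt {A : Type*} [CommMonoid A] {n k : ℕ} (hk : k ≤ n) (p q : A) :
    ∏ j : Fin n, (if j.val < k then p else q) = p ^ k * q ^ (n - k) := by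
  rw [Finset.prod_ite, Finset.prod_const, Finset.prod_const, Fin.card_filter_val_lt,
    Finset.filter_not, Finset.card_sdiff_of_subset (Finset.filter_subset _ _),
    Fin.card_filter_val_lt]
  simp [hk]

open Polynomial in
theorem sum_choose_odd_mul_X_pow (n : ℕ) :
    -∑ k ∈ (Finset.range (n + 1)).filter (fun k => 2 * k + 1 ≤ n + 1),
        ((n + 1).choose (2 * k + 1) : ℂ) • (X ^ (2 * k) : ℂ[X]) =
      ∑ k ∈ Finset.Icc 1 (n + 1), ((-1 : ℂ) ^ (n + 1 - k + 1)) •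
        ((X + 1) ^ (k - 1) * (X - 1) ^ (n - (k - 1)) : ℂ[X]) := by
  have h2X : (2 * X : ℂ[X]) ≠ 0 := mul_ne_zero two_ne_zero X_ne_zero
  apply mul_left_cancel₀ h2X
  have hR : ∑ k ∈ Finset.Icc 1 (n + 1), ((-1 : ℂ) ^ (n + 1 - k + 1)) •
        ((X + 1) ^ (k - 1) * (X - 1) ^ (n - (k - 1)) : ℂ[X]) =
      -∑ i ∈ Finset.range (n + 1), (X + 1 : ℂ[X]) ^ i * (1 - X) ^ (n + 1 - 1 - i) := by
    rw [Finset.range_eq_Ico, Finset.sum_Ico_eq_sum_range, ← Finset.sum_neg_distrib,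
      ← Finset.Ico_add_one_right_eq_Icc, Finset.sum_Ico_eq_sum_range]
    refine Finset.sum_congr (by simp) fun i _ => ?_
    have h : (1 - X : ℂ[X]) = (-1) * (X - 1) := by ring
    have e : n + 1 - (1 + i) = n - i := by omega
    simp only [smul_eq_C_mul, h, mul_pow, e, zero_add, Nat.add_sub_cancel_left,
      Nat.add_sub_cancel, pow_succ, map_mul, map_pow, map_neg, map_one]
    ring
  have hg := (Commute.all (X + 1 : ℂ[X]) (1 - X)).mul_geom_sum₂ (n + 1)
  have hX : (X + 1 - (1 - X) : ℂ[X]) = 2 * X := by ring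
  rw [hX] at hg
  rw [hR, mul_neg, mul_neg, hg, neg_inj]
  have h1 : (1 - X : ℂ[X]) = -X + 1 := by ring
  rw [h1, add_pow, add_pow, ← Finset.sum_sub_distrib, Finset.mul_sum]
  refine Finset.sum_bij_ne_zero (fun k _ _ => 2 * k + 1) ?_ ?_ ?_ ?_
  · intro k hk _
    simp at hk ⊢
    omega
  · intro a _ _ b _ _ h
    omega
  · intro j hj hne
    rcases Nat.even_or_odd' j with ⟨k, rfl | rfl⟩
    · simp [pow_mul] at hne
    · refine ⟨k, ?_, ?_, rfl⟩
      · simp at hj ⊢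
        omega
      · simp only [Finset.mem_range] at hj
        refine mul_ne_zero h2X (smul_ne_zero ?_ (pow_ne_zero _ X_ne_zero))
        exact_mod_cast (Nat.choose_pos (by omega)).ne'
  · intro k _ _
    simp only [smul_eq_C_mul, map_natCast, one_pow, neg_pow (X : ℂ[X]) (2 * k + 1), pow_succ, pow_mul]
    simp
    ring

/-- Let `W` be a complex vector space, `m ≥ 1`, and let
`s : {1,…,m} → ℝ`, `u, w : {1,…,m} → W` be arbitrary assignments. Then in the exterior
power `Λ^{m−1}_ℂ W` (realized inside the exterior algebra `Λ_ℂ W`) one has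
`−Alt_m [ Σ_{k≥0, 2k+1≤m} (C(m,2k+1)/m!) · s_1 · u_2∧…∧u_{2k+1} ∧ w_{2k+2}∧…∧w_m ]
  = Alt_m [ Σ_{k=1}^{m} ((−1)^{m−k−1}/m!) · s_1 · (u_2+w_2)∧…∧(u_k+w_k) ∧
       (u_{k+1}−w_{k+1})∧…∧(u_m−w_m) ]`,
where `Alt_m` simultaneously permutes the triples `(s_j, u_j, w_j)`.
(Indices are written `0`-based via `Fin m`; `(−1)^{m−k−1}` is written as the equal
quantity `(−1)^{m−k+1}` to avoid negative exponents.) -/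
theorem stmt_0 (W : Type*) [AddCommGroup W] [Module ℂ W] (m : ℕ) (hm : 1 ≤ m)
    (s : Fin m → ℝ) (u w : Fin m → W) :
    -(∑ σ : Equiv.Perm (Fin m), (Equiv.Perm.sign σ : ℤ) •
        ∑ k ∈ (Finset.range m).filter (fun k => 2 * k + 1 ≤ m),
          (((m.choose (2 * k + 1) : ℂ) / (m.factorial : ℂ)) * (s (σ ⟨0, hm⟩) : ℂ)) •
            (((((List.finRange m).drop 1).take (2 * k)).map
                (fun j => ι ℂ (u (σ j)))).prod *
             (((List.finRange m).drop (2 * k + 1)).map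
                (fun j => ι ℂ (w (σ j)))).prod))
    = ∑ σ : Equiv.Perm (Fin m), (Equiv.Perm.sign σ : ℤ) •
        ∑ k ∈ Finset.Icc 1 m,
          (((-1 : ℂ) ^ (m - k + 1) / (m.factorial : ℂ)) * (s (σ ⟨0, hm⟩) : ℂ)) •
            (((((List.finRange m).drop 1).take (k - 1)).map
                (fun j => ι ℂ (u (σ j)) + ι ℂ (w (σ j)))).prod *
             (((List.finRange m).drop k).map
                (fun j => ι ℂ (u (σ j)) - ι ℂ (w (σ j)))).prod) := by
  obtain ⟨n, rfl⟩ : ∃ n, m = n + 1 := ⟨m - 1, by omega⟩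
  obtain ⟨L, hL⟩ := exists_linearMap_alt_eq (fun i => (s i : ℂ)) u w
  have hU (k : ℕ) (hk : k ≤ n) (c : ℂ) :
      ∑ σ : Equiv.Perm (Fin (n + 1)), (Equiv.Perm.sign σ : ℤ) •
        (c / ((n + 1).factorial : ℂ) * (s (σ ⟨0, hm⟩) : ℂ)) •
            (((((List.finRange (n + 1)).drop 1).take k).map
                (fun j => ι ℂ (u (σ j)))).prod *
             (((List.finRange (n + 1)).drop (k + 1)).map
                (fun j => ι ℂ (w (σ j)))).prod) =
      ((n + 1).factorial : ℂ)⁻¹ • L (c • Polynomial.X ^ k) := by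
    have h := hL (fun j => if j.val < k then 1 else 0) (fun j => if j.val < k then 0 else 1)
    have hp : ∀ j : Fin n, Polynomial.C (if j.val < k then (1 : ℂ) else 0) * Polynomial.X +
        Polynomial.C (if j.val < k then (0 : ℂ) else 1) =
        if j.val < k then Polynomial.X else 1 := by
      intro j; split_ifs <;> simp
    simp only [hp, Fin.prod_ite_val_lt hk, one_pow, mul_one] at h
    rw [map_smul, ← h, Finset.smul_sum, Finset.smul_sum]
    refine Finset.sum_congr rfl fun σ _ => ?_
    rw [List.prod_take_mul_prod_drop_finRange, ιMulti_apply, smul_comm c, smul_comm ((n + 1).factorial : ℂ)⁻¹,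
      smul_smul, smul_smul]
    congr 2
    · rw [Fin.mk_zero]; ring
    · congr 2
      ext j
      split_ifs <;> simp
  have hV (k : ℕ) (hk : k ≤ n) (c : ℂ) :
      ∑ σ : Equiv.Perm (Fin (n + 1)), (Equiv.Perm.sign σ : ℤ) •
        (c / ((n + 1).factorial : ℂ) * (s (σ ⟨0, hm⟩) : ℂ)) •
            (((((List.finRange (n + 1)).drop 1).take k).map
                (fun j => ι ℂ (u (σ j)) + ι ℂ (w (σ j)))).prod *
             (((List.finRange (n + 1)).drop (k + 1)).map
                (fun j => ι ℂ (u (σ j)) - ι ℂ (w (σ j)))).prod) =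
      ((n + 1).factorial : ℂ)⁻¹ •
        L (c • ((Polynomial.X + 1) ^ k * (Polynomial.X - 1) ^ (n - k))) := by
    have h := hL (fun _ => 1) (fun j => if j.val < k then 1 else -1)
    have hp : ∀ j : Fin n, Polynomial.C (1 : ℂ) * Polynomial.X +
        Polynomial.C (if j.val < k then (1 : ℂ) else -1) =
        if j.val < k then Polynomial.X + 1 else Polynomial.X - 1 := by
      intro j; split_ifs <;> simp [sub_eq_add_neg]
    simp only [hp, Fin.prod_ite_val_lt hk] at h
    rw [map_smul, ← h, Finset.smul_sum, Finset.smul_sum]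
    refine Finset.sum_congr rfl fun σ _ => ?_
    rw [List.prod_take_mul_prod_drop_finRange, ιMulti_apply, smul_comm c, smul_comm ((n + 1).factorial : ℂ)⁻¹,
      smul_smul, smul_smul]
    congr 2
    · rw [Fin.mk_zero]; ring
    · congr 2
      ext j
      split_ifs <;> simp [sub_eq_add_neg]
  simp only [Finset.smul_sum]
  rw [Finset.sum_comm, Finset.sum_comm (t := Finset.Icc 1 (n + 1))]
  have hl := Finset.sum_congr rfl
    fun k (hk : k ∈ (Finset.range (n + 1)).filter (fun k => 2 * k + 1 ≤ n + 1)) =>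
      hU (2 * k) (by simp at hk; omega) ((n + 1).choose (2 * k + 1))
  have hr := Finset.sum_congr rfl fun k (hk : k ∈ Finset.Icc 1 (n + 1)) =>
      hV (k - 1) (by simp at hk; omega) ((-1) ^ (n + 1 - k + 1))
  rw [hl]
  refine Eq.trans ?_ (hr.symm.trans (Finset.sum_congr rfl fun k hk => ?_))
  · rw [← Finset.smul_sum, ← Finset.smul_sum, ← smul_neg, ← map_sum, ← map_sum, ← map_neg,
      sum_choose_odd_mul_X_pow]
  · rw [Nat.sub_add_cancel (Finset.mem_Icc.1 hk).1]
end

section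
/- Let V be a real vector space, n ≥ 1, and let s : {1,…,2n} → ℝ and u, v : {1,…,2n} → V be arbitrary assignments. Work in the exterior algebra Λ_ℝ(V) ⊗_ℝ ℂ of ℂ-valued forms, with conjugation ξ ↦ ξ̄ given by complex conjugation on the ℂ-factor (fixing elements of V). Then −Alt_{2n} [ Σ_{k=0}^{n−1} (C(2n,2k+1)/(2n)!) · s_1 · u_2∧…∧u_{2k+1} ∧ (i v_{2k+2})∧…∧(i v_{2n}) ] = Alt_{2n} [ (η − η̄)/2 ], where η := Σ_{k=n+1}^{2n} (2(−1)^{k−1}/(2n)!) · s_1 · (u_2 + i v_2)∧…∧(u_k + i v_k) ∧ (u_{k+1} − i v_{k+1})∧…∧(u_{2n} − i v_{2n}), and Alt_{2n} acts by simultaneously permuting the triples (s_j, u_j, v_j). (This is the pointwise/formal content of the first part of Corollary 2.2: the expression for r_{2n}(f_1,…,f_{2n}), obtained by substituting s_j = log|f_j|, u_j = d log|f_j|, v_j = d arg f_j, so that u_j + i v_j = d log f_j, u_j − i v_j = d(conjugate of log f_j), and (η − η̄)/2 = π_{2n}(η).) -/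
open TensorProduct

/-- The complexified exterior algebra `Λ_ℝ(V) ⊗_ℝ ℂ` of `ℂ`-valued forms. -/
noncomputable abbrev CForms (V : Type*) [AddCommGroup V] [Module ℝ V] : Type _ :=
  ExteriorAlgebra ℝ V ⊗[ℝ] ℂ

/-- The element `x` of `V`, viewed as a (real) `1`-form in `Λ_ℝ(V) ⊗_ℝ ℂ`. -/
noncomputable def oneForm {V : Type*} [AddCommGroup V] [Module ℝ V] (x : V) : CForms V :=
  (ExteriorAlgebra.ι ℝ x) ⊗ₜ[ℝ] (1 : ℂ)

/-- The element `i·x` for `x ∈ V`, viewed as a `1`-form in `Λ_ℝ(V) ⊗_ℝ ℂ`. -/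
noncomputable def ioneForm {V : Type*} [AddCommGroup V] [Module ℝ V] (x : V) : CForms V :=
  (ExteriorAlgebra.ι ℝ x) ⊗ₜ[ℝ] Complex.I

/-- Conjugation on `Λ_ℝ(V) ⊗_ℝ ℂ`: complex conjugation on the `ℂ`-factor, fixing `V`. -/
noncomputable def conjForm {V : Type*} [AddCommGroup V] [Module ℝ V] :
    CForms V →ₐ[ℝ] CForms V :=
  Algebra.TensorProduct.map (AlgHom.id ℝ (ExteriorAlgebra ℝ V)) Complex.conjAe.toAlgHom

/-- The form `η := Σ_{k=n+1}^{2n} (2(−1)^{k−1}/(2n)!) · s_1 ·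
(u_2 + i v_2)∧…∧(u_k + i v_k) ∧ (u_{k+1} − i v_{k+1})∧…∧(u_{2n} − i v_{2n})`,
with the triples `(s_j, u_j, v_j)` permuted by `σ` (indices written `0`-based). -/
noncomputable def eta15 {V : Type*} [AddCommGroup V] [Module ℝ V] (n : ℕ) (h0 : 0 < 2 * n)
    (s : Fin (2 * n) → ℝ) (u v : Fin (2 * n) → V) (σ : Equiv.Perm (Fin (2 * n))) :
    CForms V :=
  ∑ k ∈ Finset.Icc (n + 1) (2 * n),
    ((2 * (-1 : ℝ) ^ (k - 1) / ((2 * n).factorial : ℝ)) * s (σ ⟨0, h0⟩)) •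
      (((((List.finRange (2 * n)).drop 1).take (k - 1)).map
          (fun j => oneForm (u (σ j)) + ioneForm (v (σ j)))).prod *
       (((List.finRange (2 * n)).drop k).map
          (fun j => oneForm (u (σ j)) - ioneForm (v (σ j)))).prod)

open Polynomial in
/-- The generating polynomial of the words `(X + 1)^j (X - 1)^(2n - 1 - j)` with alternating signs. -/
theorem sum_neg_one_pow_mul_eq_neg_sum_choose (n : ℕ) :
    ∑ j ∈ Finset.range (2 * n), (-1 : ℝ[X]) ^ j * ((X + 1) ^ j * (X - 1) ^ (2 * n - 1 - j)) =
      -∑ k ∈ Finset.range n, ((2 * n).choose (2 * k + 1) : ℝ[X]) * X ^ (2 * k) := by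
  have hX : (-(X + 1) - (X - 1) : ℝ[X]) ≠ 0 := by
    have : (-(X + 1) - (X - 1) : ℝ[X]) = C (-2) * X := by
      rw [C_neg, show (C 2 : ℝ[X]) = 2 from rfl]; ring
    rw [this]
    exact mul_ne_zero (by simp) X_ne_zero
  apply mul_right_cancel₀ hX
  have hsum : ∀ (h : ℕ → ℝ[X]) (n : ℕ), ∑ l ∈ Finset.range (2 * n), h l =
      ∑ k ∈ Finset.range n, (h (2 * k) + h (2 * k + 1)) := by
    intro h n
    induction n with
    | zero => simp
    | succ n ih =>
      rw [Finset.sum_range_succ, ← ih, mul_add, mul_one, Finset.sum_range_succ,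
        Finset.sum_range_succ, add_assoc]
  have hl : ∀ j ∈ Finset.range (2 * n),
      (-1 : ℝ[X]) ^ j * ((X + 1) ^ j * (X - 1) ^ (2 * n - 1 - j)) =
        (-(X + 1)) ^ j * (X - 1) ^ (2 * n - 1 - j) := by
    intro j _
    rw [← mul_assoc, ← mul_pow, neg_one_mul]
  rw [Finset.sum_congr rfl hl, geom_sum₂_mul, (even_two_mul n).neg_pow, sub_eq_add_neg X 1,
    add_pow, add_pow, Finset.sum_range_succ, Finset.sum_range_succ, hsum, hsum,
    add_sub_add_comm, ← Finset.sum_sub_distrib, neg_mul, Finset.sum_mul, ← Finset.sum_neg_distrib]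
  simp only [one_pow, mul_one, Nat.sub_self, pow_zero, sub_self, add_zero]
  refine Finset.sum_congr rfl fun k hk => ?_
  have hk := Finset.mem_range.1 hk
  have he : Even (2 * n - 2 * k) := ⟨n - k, by omega⟩
  have ho : Odd (2 * n - (2 * k + 1)) := ⟨n - k - 1, by omega⟩
  rw [he.neg_one_pow, ho.neg_one_pow]
  ring

open Polynomial in
theorem sum_alternating_words_sub_swap (n : ℕ) :
    ∑ i ∈ Finset.range n, ((-1 : ℝ) ^ (n + i) • ((X + 1 : ℝ[X]) ^ (n + i) * (X - 1) ^ (n - 1 - i)) -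
        (-1 : ℝ) ^ (n + i) • ((X - 1 : ℝ[X]) ^ (n + i) * (X + 1) ^ (n - 1 - i))) =
      -∑ k ∈ Finset.range n, ((2 * n).choose (2 * k + 1) : ℝ) • (X : ℝ[X]) ^ (2 * k) := by
  have hc : ∀ (r : ℝ) (p : ℝ[X]), r • p = C r * p := fun r p => smul_eq_C_mul r
  simp only [hc, C_pow, C_neg, C_1, map_natCast]
  rw [← sum_neg_one_pow_mul_eq_neg_sum_choose, two_mul, Finset.sum_range_add,
    Finset.sum_sub_distrib, sub_eq_add_neg, add_comm, ← Finset.sum_neg_distrib]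
  congr 1
  · rw [← Finset.sum_range_reflect]
    refine Finset.sum_congr rfl fun i hi => ?_
    have hi := Finset.mem_range.1 hi
    have h1 : n + (n - 1 - i) = n + n - 1 - i := by omega
    have h2 : n - 1 - (n - 1 - i) = i := by omega
    have h3 : (-1 : ℝ[X]) ^ (n + n - 1 - i) = -(-1) ^ i := by
      have : (-1 : ℝ[X]) ^ (n + n - 1 - i) * (-1) ^ (i + 1) = 1 := by
        rw [← pow_add, show n + n - 1 - i + (i + 1) = n + n by omega, Even.neg_one_pow ⟨n, rfl⟩]
      rcases neg_one_pow_eq_or ℝ[X] i with h | h <;> rw [pow_succ, h] at this <;>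
        rw [h] <;> first | linear_combination this | linear_combination -this
    rw [h1, h2, h3]
    ring
  · refine Finset.sum_congr rfl fun i _ => ?_
    rw [show n + n - 1 - (n + i) = n - 1 - i by omega]

section Alternation

variable {E A : Type*} [AddCommGroup E] [Module ℝ E] [AddCommGroup A] [Module ℝ A]

/-- The alternation of `s₀ · f(z₁, …, zₘ)` for an alternating map `f` in the last `m` arguments. -/
noncomputable def altSum {m : ℕ} (f : E [⋀^Fin m]→ₗ[ℝ] A) (s : Fin (m + 1) → ℝ)
    (z : Fin m → Fin (m + 1) → E) : A :=
  ∑ σ : Equiv.Perm (Fin (m + 1)), (Equiv.Perm.sign σ : ℤ) •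
    s (σ 0) • f (fun j => z j (σ j.succ))

theorem altSum_comp_perm {m : ℕ} (f : E [⋀^Fin m]→ₗ[ℝ] A) (s : Fin (m + 1) → ℝ)
    (z : Fin m → Fin (m + 1) → E) (τ : Equiv.Perm (Fin m)) :
    altSum f s (z ∘ τ) = altSum f s z := by
  unfold altSum
  rw [← Equiv.sum_comp (Equiv.mulRight (Equiv.Perm.decomposeFin.symm (0, τ)))]
  refine Finset.sum_congr rfl fun ρ _ => ?_
  have hf : f (fun j => z (τ j) (ρ (τ j).succ)) =
      Equiv.Perm.sign τ • f (fun j => z j (ρ j.succ)) :=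
    f.map_perm (fun j => z j (ρ j.succ)) τ
  simp only [Equiv.coe_mulRight, Equiv.Perm.sign_mul, Equiv.Perm.decomposeFin.symm_sign, if_true,
    one_mul, Equiv.Perm.mul_apply, Equiv.Perm.decomposeFin_symm_apply_zero,
    Equiv.Perm.decomposeFin_symm_apply_succ, Equiv.swap_self, Equiv.refl_apply,
    Function.comp_apply, hf]
  rcases Int.units_eq_one_or (Equiv.Perm.sign τ) with h | h <;> simp [h]

theorem altSum_piecewise_eq_of_card_eq {m : ℕ} (f : E [⋀^Fin m]→ₗ[ℝ] A) (s : Fin (m + 1) → ℝ)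
    (x y : Fin (m + 1) → E) {S T : Finset (Fin m)} (h : S.card = T.card) :
    altSum f s (S.piecewise (fun _ => x) fun _ => y) =
      altSum f s (T.piecewise (fun _ => x) fun _ => y) := by
  let e : {j // j ∈ S} ≃ {j // j ∈ T} := Finset.equivOfCardEq h
  rw [← altSum_comp_perm f s (T.piecewise (fun _ => x) fun _ => y) e.extendSubtype]
  congr 1
  funext j
  by_cases hj : j ∈ S
  · have := e.extendSubtype_mem j hj
    simp [Finset.piecewise, hj, this]
  · have := e.extendSubtype_not_mem j hj
    simp [Finset.piecewise, hj, this]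

theorem altSum_smul_add_smul {m : ℕ} (f : E [⋀^Fin m]→ₗ[ℝ] A) (s : Fin (m + 1) → ℝ)
    (x y : Fin (m + 1) → E) (a b : Fin m → ℝ) :
    altSum f s (fun j i => a j • x i + b j • y i) =
      ∑ S : Finset (Fin m), ((∏ j ∈ S, a j) * ∏ j ∈ Sᶜ, b j) •
        altSum f s (S.piecewise (fun _ => x) fun _ => y) := by
  have hf : ∀ σ : Equiv.Perm (Fin (m + 1)),
      f (fun j => a j • x (σ j.succ) + b j • y (σ j.succ)) =
        ∑ S : Finset (Fin m), ((∏ j ∈ S, a j) * ∏ j ∈ Sᶜ, b j) •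
          f (fun j => S.piecewise (fun _ => x) (fun _ => y) j (σ j.succ)) := by
    intro σ
    refine (f.toMultilinearMap.map_add_univ (fun j => a j • x (σ j.succ))
      fun j => b j • y (σ j.succ)).trans (Finset.sum_congr rfl fun S _ => ?_)
    have hS : (S.piecewise (fun j => a j • x (σ j.succ)) fun j => b j • y (σ j.succ)) =
        fun j => S.piecewise a b j • S.piecewise (fun _ => x) (fun _ => y) j (σ j.succ) := by
      funext j
      by_cases hj : j ∈ S <;> simp [hj]
    rw [hS, MultilinearMap.map_smul_univ, Finset.prod_piecewise, Finset.univ_inter,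
      ← Finset.compl_eq_univ_sdiff]
    rfl
  simp only [altSum, hf, Finset.smul_sum]
  rw [Finset.sum_comm]
  refine Finset.sum_congr rfl fun S _ => Finset.sum_congr rfl fun σ _ => ?_
  rw [smul_comm (s (σ 0)), smul_comm (Equiv.Perm.sign σ : ℤ)]

open Polynomial in
/-- An alternation of words in `x` and `y` depends only on the commutative polynomial of the word,
with `x` replaced by `X` and `y` by `1`. -/
theorem exists_linearMap_altSum_eq {m : ℕ} (f : E [⋀^Fin m]→ₗ[ℝ] A) (s : Fin (m + 1) → ℝ)
    (x y : Fin (m + 1) → E) :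
    ∃ Λ : ℝ[X] →ₗ[ℝ] A, ∀ a b : Fin m → ℝ,
      altSum f s (fun j i => a j • x i + b j • y i) = Λ (∏ j, (C (a j) * X + C (b j))) := by
  classical
  let G : ℕ → A := fun p =>
    if h : ∃ S : Finset (Fin m), S.card = p then
      altSum f s (h.choose.piecewise (fun _ => x) fun _ => y)
    else 0
  have hG : ∀ S : Finset (Fin m),
      G S.card = altSum f s (S.piecewise (fun _ => x) fun _ => y) := by
    intro S
    have h : ∃ T : Finset (Fin m), T.card = S.card := ⟨S, rfl⟩
    simp only [G, dif_pos h]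
    exact altSum_piecewise_eq_of_card_eq f s x y h.choose_spec
  refine ⟨Polynomial.lsum fun p => LinearMap.toSpanSingleton ℝ A (G p), fun a b => ?_⟩
  rw [altSum_smul_add_smul, Fintype.prod_add, map_sum]
  refine Finset.sum_congr rfl fun S _ => ?_
  rw [Finset.prod_mul_distrib, Finset.prod_const, ← map_prod, ← map_prod, mul_right_comm,
    ← C_mul, C_mul_X_pow_eq_monomial, Polynomial.lsum_apply, sum_monomial_index _ _ (by simp),
    LinearMap.toSpanSingleton_apply, hG]

end Alternation

theorem List.take_finRange_mul_drop_finRange {M : Type*} [Monoid M] {m k : ℕ} (hk : k ≤ m)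
    (p q : Fin (m + 1) → M) :
    ((((List.finRange (m + 1)).drop 1).take k).map p).prod *
        (((List.finRange (m + 1)).drop (k + 1)).map q).prod =
      (List.ofFn fun j : Fin m => if (j : ℕ) < k then p j.succ else q j.succ).prod := by
  rw [← List.prod_append]
  congr 1
  apply List.ext_getElem
  · simp; omega
  · intro i h₁ h₂
    simp only [List.getElem_append, List.getElem_ofFn, List.getElem_map, List.getElem_take,
      List.getElem_drop, List.getElem_finRange, List.length_map, List.length_take,
      List.length_drop, List.length_finRange]
    have hi : i < m := by simpa using h₂
    by_cases h : i < k
    · rw [dif_pos (by omega), if_pos h]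
      congr 1
      ext
      simp [add_comm]
    · rw [dif_neg (by omega), if_neg h]
      congr 1
      ext
      simp
      omega

section Forms

variable {V : Type*} [AddCommGroup V] [Module ℝ V]

/-- The complex `1`-form `x + i·y`. -/
noncomputable def complexOneForm (V : Type*) [AddCommGroup V] [Module ℝ V] :
    V × V →ₗ[ℝ] CForms V :=
  LinearMap.coprod
    ((TensorProduct.mk ℝ (ExteriorAlgebra ℝ V) ℂ).flip 1 ∘ₗ ExteriorAlgebra.ι ℝ)
    ((TensorProduct.mk ℝ (ExteriorAlgebra ℝ V) ℂ).flip Complex.I ∘ₗ ExteriorAlgebra.ι ℝ)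

theorem complexOneForm_apply (x y : V) :
    complexOneForm V (x, y) = oneForm x + ioneForm y := rfl

theorem complexOneForm_mul_self (z : V × V) : complexOneForm V z * complexOneForm V z = 0 := by
  obtain ⟨x, y⟩ := z
  rw [complexOneForm_apply]
  simp only [oneForm, ioneForm, add_mul, mul_add, Algebra.TensorProduct.tmul_mul_tmul,
    ExteriorAlgebra.ι_sq_zero, TensorProduct.zero_tmul, mul_one, one_mul, zero_add, add_zero]
  rw [← TensorProduct.add_tmul, ExteriorAlgebra.ι_add_mul_swap, TensorProduct.zero_tmul]

/-- The wedge product of `m` complex `1`-forms. -/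
noncomputable def wedgeForms (V : Type*) [AddCommGroup V] [Module ℝ V] (m : ℕ) :
    (V × V) [⋀^Fin m]→ₗ[ℝ] CForms V :=
  (ExteriorAlgebra.lift ℝ ⟨complexOneForm V, complexOneForm_mul_self⟩).toLinearMap.compAlternatingMap
    (ExteriorAlgebra.ιMulti ℝ m)

theorem wedgeForms_apply {m : ℕ} (z : Fin m → V × V) :
    wedgeForms V m z = (List.ofFn fun j => complexOneForm V (z j)).prod := by
  simp only [wedgeForms, LinearMap.compAlternatingMap_apply, AlgHom.toLinearMap_apply,
    ExteriorAlgebra.ιMulti_apply, map_list_prod, List.map_ofFn]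
  congr 2
  funext j
  simp [ExteriorAlgebra.lift_ι_apply]

open Polynomial in
theorem exists_linearMap_alt_words_eq {N m : ℕ} (hN : N = m + 1) (s : Fin N → ℝ)
    (u v : Fin N → V) :
    ∃ Λ : ℝ[X] →ₗ[ℝ] CForms V, ∀ (k : ℕ), k ≤ m → ∀ a b c d : ℝ,
      ∑ σ : Equiv.Perm (Fin N), (Equiv.Perm.sign σ : ℤ) • s (σ ⟨0, by omega⟩) •
        (((((List.finRange N).drop 1).take k).map
            (fun j => a • oneForm (u (σ j)) + b • ioneForm (v (σ j)))).prod *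
          (((List.finRange N).drop (k + 1)).map
            (fun j => c • oneForm (u (σ j)) + d • ioneForm (v (σ j)))).prod) =
        Λ ((C a * X + C b) ^ k * (C c * X + C d) ^ (m - k)) := by
  subst hN
  obtain ⟨Λ, hΛ⟩ := exists_linearMap_altSum_eq (wedgeForms V m) s
    (fun i => (u i, 0)) (fun i => (0, v i))
  refine ⟨Λ, fun k hk a b c d => ?_⟩
  have hprod : (∏ j : Fin m, (C (if (j : ℕ) < k then a else c) * X +
      C (if (j : ℕ) < k then b else d))) =
        ((C a * X + C b) ^ k * (C c * X + C d) ^ (m - k) : ℝ[X]) := by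
    have h : ∀ j : ℕ, (C (if j < k then a else c) * X + C (if j < k then b else d) : ℝ[X]) =
        if j < k then C a * X + C b else C c * X + C d := fun j => by split_ifs <;> rfl
    simp only [h]
    rw [Fin.prod_univ_eq_prod_range
      (fun j => if j < k then (C a * X + C b : ℝ[X]) else C c * X + C d) m,
      ← Finset.prod_range_mul_prod_Ico _ hk]
    congr 1
    · rw [Finset.prod_congr rfl fun j hj => if_pos (Finset.mem_range.1 hj)]
      simp
    · rw [Finset.prod_congr rfl fun j hj => if_neg (not_lt.2 (Finset.mem_Ico.1 hj).1)]
      simp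
  rw [← hprod, ← hΛ, altSum]
  refine Finset.sum_congr rfl fun σ _ => ?_
  rw [List.take_finRange_mul_drop_finRange hk, wedgeForms_apply]
  congr 4
  funext j
  have hz : ∀ (p q : ℝ) (i : Fin (m + 1)),
      complexOneForm V (p • (u i, (0 : V)) + q • ((0 : V), v i)) =
        p • oneForm (u i) + q • ioneForm (v i) := by
    intro p q i
    rw [map_add, map_smul, map_smul, complexOneForm_apply, complexOneForm_apply]
    simp [oneForm, ioneForm]
  rw [hz]
  split_ifs <;> rfl

theorem conjForm_oneForm (x : V) : conjForm (oneForm x) = oneForm x := by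
  simp [conjForm, oneForm]

theorem conjForm_ioneForm (x : V) : conjForm (ioneForm x) = -ioneForm x := by
  simp [conjForm, ioneForm, TensorProduct.tmul_neg]

theorem conjForm_eta15 (n : ℕ) (h0 : 0 < 2 * n) (s : Fin (2 * n) → ℝ) (u v : Fin (2 * n) → V)
    (σ : Equiv.Perm (Fin (2 * n))) :
    conjForm (eta15 n h0 s u v σ) = eta15 n h0 s u (-v) σ := by
  have hneg : ∀ x : V, ioneForm (-x) = -ioneForm x := fun x => by
    simp [ioneForm, TensorProduct.neg_tmul]
  simp only [eta15, map_sum, map_smul, map_mul, map_list_prod, List.map_map, Function.comp_def,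
    map_add, map_sub, conjForm_oneForm, conjForm_ioneForm, Pi.neg_apply, hneg]

end Forms

/-- Let `V` be a real vector space, `n ≥ 1`, and `s : {1,…,2n} → ℝ`,
`u, v : {1,…,2n} → V` arbitrary assignments.  In `Λ_ℝ(V) ⊗_ℝ ℂ` one has
`−Alt_{2n} [ Σ_{k=0}^{n−1} (C(2n,2k+1)/(2n)!) · s_1 · u_2∧…∧u_{2k+1} ∧
  (i v_{2k+2})∧…∧(i v_{2n}) ]  =  Alt_{2n} [ (η − η̄)/2 ]`,
where `η` is as in `eta15` and `Alt_{2n}` simultaneously permutes the triples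
`(s_j, u_j, v_j)`. -/
theorem stmt_15 (V : Type*) [AddCommGroup V] [Module ℝ V] (n : ℕ) (hn : 1 ≤ n)
    (s : Fin (2 * n) → ℝ) (u v : Fin (2 * n) → V) :
    -(∑ σ : Equiv.Perm (Fin (2 * n)), (Equiv.Perm.sign σ : ℤ) •
        ∑ k ∈ Finset.range n,
          ((((2 * n).choose (2 * k + 1) : ℝ) / ((2 * n).factorial : ℝ)) *
              s (σ ⟨0, by omega⟩)) •
            (((((List.finRange (2 * n)).drop 1).take (2 * k)).map
                (fun j => oneForm (u (σ j)))).prod *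
             (((List.finRange (2 * n)).drop (2 * k + 1)).map
                (fun j => ioneForm (v (σ j)))).prod))
    = ∑ σ : Equiv.Perm (Fin (2 * n)), (Equiv.Perm.sign σ : ℤ) •
        ((1 / 2 : ℝ) • (eta15 n (by omega) s u v σ - conjForm (eta15 n (by omega) s u v σ))) := by
  obtain ⟨Λ, hΛ⟩ := exists_linearMap_alt_words_eq (m := 2 * n - 1) (by omega) s u v
  have hsmul : ∀ (r : ℝ) (P : Equiv.Perm (Fin (2 * n)) → CForms V),
      ∑ σ : Equiv.Perm (Fin (2 * n)), (Equiv.Perm.sign σ : ℤ) •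
          (r * s (σ ⟨0, by omega⟩)) • P σ =
        r • ∑ σ : Equiv.Perm (Fin (2 * n)), (Equiv.Perm.sign σ : ℤ) •
          s (σ ⟨0, by omega⟩) • P σ := by
    intro r P
    rw [Finset.smul_sum]
    refine Finset.sum_congr rfl fun σ _ => ?_
    rw [mul_smul]
    exact smul_comm _ _ _
  have add_neg_smul : ∀ (r : ℝ) (p q : CForms V), p + -r • q = p - r • q := fun r p q => by
    rw [sub_eq_add_neg]
    exact congrArg _ (neg_smul r q)
  have smul_sub_form : ∀ (r : ℝ) (p q : CForms V), r • (p - q) = r • p - r • q := smul_sub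
  have map_sub_form : ∀ p q : Polynomial ℝ, Λ p - Λ q = Λ (p - q) := fun p q => (map_sub Λ p q).symm
  have smul_map_neg : ∀ (r : ℝ) (p : Polynomial ℝ), r • Λ (-p) = -(r • Λ p) := fun r p =>
    (congrArg (r • ·) (map_neg Λ p)).trans (smul_neg r (Λ p))
  have heta : ∀ ε : ℝ, ∑ σ : Equiv.Perm (Fin (2 * n)), (Equiv.Perm.sign σ : ℤ) •
      eta15 n (by omega) s u (ε • v) σ =
        (2 / ((2 * n).factorial : ℝ)) • Λ (∑ i ∈ Finset.range n, (-1 : ℝ) ^ (n + i) •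
          ((Polynomial.X + Polynomial.C ε) ^ (n + i) * (Polynomial.X - Polynomial.C ε) ^ (n - 1 - i))) := by
    intro ε
    have hI : ∀ x : V, ioneForm (ε • x) = ε • ioneForm x := fun x => by
      simp [ioneForm, TensorProduct.smul_tmul']
    simp only [eta15, Finset.smul_sum, map_sum, map_smul]
    rw [Finset.sum_comm, ← Finset.Ico_succ_right_eq_Icc, Finset.sum_Ico_eq_sum_range,
      show Order.succ (2 * n) - (n + 1) = n by simp [Order.succ]; omega]
    refine Finset.sum_congr rfl fun i hi => ?_
    have hi := Finset.mem_range.1 hi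
    have h := hΛ (n + i) (by omega) 1 ε 1 (-ε)
    rw [show 2 * n - 1 - (n + i) = n - 1 - i by omega] at h
    simp only [one_smul, add_neg_smul, ← sub_eq_add_neg, Polynomial.C_1, one_mul, Polynomial.C_neg] at h
    rw [hsmul, show n + 1 + i = n + i + 1 by ring, Nat.add_sub_cancel]
    simp only [Pi.smul_apply, hI]
    rw [h, smul_smul]
    congr 1
    ring
  have hword : ∀ k ∈ Finset.range n, ∑ σ : Equiv.Perm (Fin (2 * n)),
      (Equiv.Perm.sign σ : ℤ) • ((((2 * n).choose (2 * k + 1) : ℝ) / ((2 * n).factorial : ℝ)) *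
          s (σ ⟨0, by omega⟩)) •
        (((((List.finRange (2 * n)).drop 1).take (2 * k)).map
            (fun j => oneForm (u (σ j)))).prod *
          (((List.finRange (2 * n)).drop (2 * k + 1)).map
            (fun j => ioneForm (v (σ j)))).prod) =
      (1 / ((2 * n).factorial : ℝ)) •
        Λ (((2 * n).choose (2 * k + 1) : ℝ) • Polynomial.X ^ (2 * k)) := by
    intro k hk
    have hk := Finset.mem_range.1 hk
    have h := hΛ (2 * k) (by omega) 1 0 0 1
    simp only [one_smul, zero_smul, add_zero, zero_add, Polynomial.C_1, Polynomial.C_0, one_mul, zero_mul, one_pow,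
      mul_one] at h
    rw [hsmul, h, map_smul, smul_smul]
    congr 1
    ring
  have h₁ := heta 1
  have h₂ := heta (-1)
  simp only [one_smul, neg_smul, Polynomial.C_1, Polynomial.C_neg, ← sub_eq_add_neg, sub_neg_eq_add] at h₁ h₂
  simp only [conjForm_eta15, smul_comm _ (1 / 2 : ℝ), smul_sub, Finset.sum_sub_distrib]
  simp only [← Finset.smul_sum]
  rw [h₁, h₂, ← smul_sub_form, ← smul_sub_form, map_sub_form, ← Finset.sum_sub_distrib,
    sum_alternating_words_sub_swap, smul_smul]
  simp only [Finset.smul_sum]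
  rw [Finset.sum_comm, Finset.sum_congr rfl hword, ← Finset.smul_sum, ← map_sum, smul_map_neg]
  congr 2
  ring
end
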